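/- Let d ≥ 3, v : ℝ^d → ℝ bounded measurable with bounded support, Y_x = ∫₀^∞ v(W_x(s)) ds. Then for every nonnegative integer k, the function x ↦ E[(Y_x)^k] is continuous on ℝ^d. -/

import Mathlib

open MeasureTheory Real Filter Topology ProbabilityTheory

noncomputable section

/-- Euclidean space `ℝ^d`. -/
abbrev Euc (d : ℕ) := EuclideanSpace ℝ (Fin d)

/-- The Brownian transition density `q(s; w) = (2πs)^{-d/2} exp(-|w|²/(2s))`. -/
def heatKernel (d : ℕ) (s : ℝ) (w : Euc d) : ℝ :=
  (2 * π * s) ^ (-(d : ℝ) / 2) * Real.exp (-‖w‖ ^ 2 / (2 * s))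

/-- Joint density of a Brownian motion started at `x`, at times `s 0 < s 1 < ⋯`. -/
def jointDensity (d : ℕ) {k : ℕ} (x : Euc d) (s : Fin k → ℝ) (z : Fin k → Euc d) : ℝ :=
  ∏ j : Fin k,
    heatKernel d (s j - if (j : ℕ) = 0 then 0 else s ⟨(j : ℕ) - 1, lt_of_le_of_lt (Nat.sub_le _ _) j.isLt⟩)
      (z j - if (j : ℕ) = 0 then x else z ⟨(j : ℕ) - 1, lt_of_le_of_lt (Nat.sub_le _ _) j.isLt⟩)

/-- Joint density of the Brownian bridge from `a` to `b` in time `t`, at interior times `s`. -/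
def bridgeDensity (d : ℕ) {k : ℕ} (t : ℝ) (a b : Euc d) (s : Fin k → ℝ) (z : Fin k → Euc d) : ℝ :=
  jointDensity d a (Fin.snoc s t) (Fin.snoc z b) / heatKernel d t (b - a)

/-- The open ordered simplex `0 < s₁ < ⋯ < s_k < t`. -/
def simplex (k : ℕ) (t : ℝ) : Set (Fin k → ℝ) :=
  {s | StrictMono s ∧ ∀ i, 0 < s i ∧ s i < t}

/-- `W` is a standard `d`-dimensional Brownian motion started at `x`, characterized by
continuous paths and finite-dimensional densities given by products of heat kernels. -/
def IsBrownianMotion {Ω : Type*} [MeasureSpace Ω] {d : ℕ} (x : Euc d)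
    (W : ℝ → Ω → Euc d) : Prop :=
  (∀ ω, W 0 ω = x) ∧ (∀ ω, Continuous fun s => W s ω) ∧
  ∀ (k : ℕ) (s : Fin (k + 1) → ℝ), StrictMono s → (∀ i, 0 < s i) →
    Measure.map (fun ω (i : Fin (k + 1)) => W (s i) ω) (ℙ : Measure Ω) =
      (volume : Measure (Fin (k + 1) → Euc d)).withDensity
        (fun z => ENNReal.ofReal (jointDensity d x s z))

/-- `X` is a `d`-dimensional Brownian bridge from `a` to `b` in time `t`. -/
def IsBrownianBridge {Ω : Type*} [MeasureSpace Ω] {d : ℕ} (t : ℝ) (a b : Euc d)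
    (X : ℝ → Ω → Euc d) : Prop :=
  (∀ ω, X 0 ω = a) ∧ (∀ ω, X t ω = b) ∧
  (∀ ω, ContinuousOn (fun s => X s ω) (Set.Icc 0 t)) ∧
  ∀ (k : ℕ) (s : Fin (k + 1) → ℝ), StrictMono s → (∀ i, 0 < s i ∧ s i < t) →
    Measure.map (fun ω (i : Fin (k + 1)) => X (s i) ω) (ℙ : Measure Ω) =
      (volume : Measure (Fin (k + 1) → Euc d)).withDensity
        (fun z => ENNReal.ofReal (bridgeDensity d t a b s z))

/-- The path integral `∫₀^t v(X_s) ds`. -/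
def pathInt {Ω : Type*} {d : ℕ} (v : Euc d → ℝ) (X : ℝ → Ω → Euc d) (t : ℝ) (ω : Ω) : ℝ :=
  ∫ s in Set.Ioc (0 : ℝ) t, v (X s ω)

/-- The total path integral `∫₀^∞ v(X_s) ds`. -/
def pathIntInf {Ω : Type*} {d : ℕ} (v : Euc d → ℝ) (X : ℝ → Ω → Euc d) (ω : Ω) : ℝ :=
  ∫ s in Set.Ioi (0 : ℝ), v (X s ω)

/-- The density ratio `Q_{j} = q(t; y - x)/q(Δ_j s; Δ_j z)` with the conventions
`s₀ = 0`, `s_{k+1} = t`, `z₀ = x`, `z_{k+1} = y`. -/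
def Qratio (d : ℕ) {k : ℕ} (t : ℝ) (x y : Euc d) (s : Fin k → ℝ) (z : Fin k → Euc d)
    (j : Fin (k + 1)) : ℝ :=
  heatKernel d t (y - x) /
    heatKernel d
      ((Fin.cons 0 (Fin.snoc s t) : Fin (k + 2) → ℝ) j.succ -
        (Fin.cons 0 (Fin.snoc s t) : Fin (k + 2) → ℝ) j.castSucc)
      ((Fin.cons x (Fin.snoc z y) : Fin (k + 2) → Euc d) j.succ -
        (Fin.cons x (Fin.snoc z y) : Fin (k + 2) → Euc d) j.castSucc)

open scoped ENNReal

/-- Tonelli's theorem on the region `t < u ≤ s`. -/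
lemma lintegral_Ioi_lintegral_Ioc_mul {g h : ℝ → ℝ≥0∞} (hg : Measurable g) (hh : Measurable h)
    (t : ℝ) :
    ∫⁻ s in Set.Ioi t, (∫⁻ u in Set.Ioc t s, g u) * h s =
      ∫⁻ u in Set.Ioi t, g u * ∫⁻ s in Set.Ioi u, h s := by
  have hm : Measurable (Function.uncurry fun s u : ℝ => if u ≤ s then g u * h s else 0) :=
    Measurable.ite (measurableSet_le measurable_snd measurable_fst)
      ((hg.comp measurable_snd).mul (hh.comp measurable_fst)) measurable_const
  calc ∫⁻ s in Set.Ioi t, (∫⁻ u in Set.Ioc t s, g u) * h s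
      = ∫⁻ s in Set.Ioi t, ∫⁻ u in Set.Ioi t, if u ≤ s then g u * h s else 0 := by
        refine lintegral_congr fun s => ?_
        rw [← lintegral_mul_const _ hg]
        have hs : Set.Ioc t s = Set.Iic s ∩ Set.Ioi t := by
          ext u; simp [and_comm]
        rw [hs, ← setLIntegral_indicator measurableSet_Iic]
        refine lintegral_congr fun u => ?_
        simp [Set.indicator_apply]
    _ = ∫⁻ u in Set.Ioi t, ∫⁻ s in Set.Ioi t, if u ≤ s then g u * h s else 0 :=
        lintegral_lintegral_swap hm.aemeasurable
    _ = ∫⁻ u in Set.Ioi t, g u * ∫⁻ s in Set.Ioi u, h s := by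
        refine setLIntegral_congr_fun measurableSet_Ioi fun u hu => ?_
        rw [← lintegral_const_mul _ hh,
          ← setLIntegral_congr (Ioi_ae_eq_Ici (a := u)).symm]
        have hs : Set.Ici u = Set.Ici u ∩ Set.Ioi t := by
          ext s
          simp only [Set.mem_Ici, Set.mem_inter_iff, Set.mem_Ioi, iff_self_and]
          exact fun h => lt_of_lt_of_le hu h
        rw [hs, ← setLIntegral_indicator measurableSet_Ici]
        refine lintegral_congr fun s => ?_
        simp [Set.indicator_apply]

lemma measurable_lintegral_Ioi (g : ℝ → ℝ≥0∞) :
    Measurable fun s => ∫⁻ u in Set.Ioi s, g u :=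
  Antitone.measurable fun _ _ h => lintegral_mono_set (Set.Ioi_subset_Ioi h)

/-- The power of a tail integral as an iterated integral. -/
lemma lintegral_Ioi_pow_succ {g : ℝ → ℝ≥0∞} (hg : Measurable g) (k : ℕ) (t : ℝ) :
    (∫⁻ u in Set.Ioi t, g u) ^ (k + 1) =
      (k + 1) * ∫⁻ s in Set.Ioi t, g s * (∫⁻ u in Set.Ioi s, g u) ^ k := by
  induction k generalizing t with
  | zero => simp
  | succ k ih =>
    have hG := measurable_lintegral_Ioi g
    have hgG : Measurable fun s => g s * (∫⁻ u in Set.Ioi s, g u) ^ k := hg.mul (hG.pow_const k)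
    have hgG' : Measurable fun s => g s * (∫⁻ u in Set.Ioi s, g u) ^ (k + 1) :=
      hg.mul (hG.pow_const (k + 1))
    have hsplit : (∫⁻ u in Set.Ioi t, g u) *
          ∫⁻ s in Set.Ioi t, g s * (∫⁻ u in Set.Ioi s, g u) ^ k =
        (∫⁻ s in Set.Ioi t, (∫⁻ u in Set.Ioc t s, g u) * (g s * (∫⁻ u in Set.Ioi s, g u) ^ k)) +
          ∫⁻ s in Set.Ioi t, g s * (∫⁻ u in Set.Ioi s, g u) ^ (k + 1) := by
      rw [← lintegral_const_mul _ hgG, ← lintegral_add_right _ hgG']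
      refine setLIntegral_congr_fun measurableSet_Ioi fun s hs => ?_
      have h1 : ∫⁻ u in Set.Ioi t, g u = (∫⁻ u in Set.Ioc t s, g u) + ∫⁻ u in Set.Ioi s, g u := by
        rw [← Set.Ioc_union_Ioi_eq_Ioi (le_of_lt hs),
          lintegral_union measurableSet_Ioi (Set.Ioc_disjoint_Ioi le_rfl)]
      rw [h1]
      ring
    have hdiag : ((k : ℝ≥0∞) + 1) * ∫⁻ s in Set.Ioi t, (∫⁻ u in Set.Ioc t s, g u) *
          (g s * (∫⁻ u in Set.Ioi s, g u) ^ k) =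
        ∫⁻ s in Set.Ioi t, g s * (∫⁻ u in Set.Ioi s, g u) ^ (k + 1) := by
      have hm : Measurable fun u => g u *
          ∫⁻ s in Set.Ioi u, g s * (∫⁻ u in Set.Ioi s, g u) ^ k :=
        hg.mul (measurable_lintegral_Ioi _)
      rw [lintegral_Ioi_lintegral_Ioc_mul hg hgG, ← lintegral_const_mul _ hm]
      refine lintegral_congr fun s => ?_
      rw [ih s]
      ring
    rw [pow_succ', ih t, mul_left_comm, hsplit, mul_add, hdiag]
    push_cast
    ring

/-- The heat semigroup acting on nonnegative functions. -/
def heatSemigroup (d : ℕ) (τ : ℝ) (φ : Euc d → ℝ≥0∞) (y : Euc d) : ℝ≥0∞ :=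
  ∫⁻ z, ENNReal.ofReal (heatKernel d τ (z - y)) * φ z

/-- The Green operator: the heat semigroup integrated over all times. -/
def greenOperator (d : ℕ) (φ : Euc d → ℝ≥0∞) (y : Euc d) : ℝ≥0∞ :=
  ∫⁻ τ in Set.Ioi (0 : ℝ), heatSemigroup d τ φ y

/-- The moments of the total path integral of `φ`, as given by iterating the Green operator. -/
def greenMoment (d : ℕ) (φ : Euc d → ℝ≥0∞) : ℕ → Euc d → ℝ≥0∞
  | 0 => fun _ => 1
  | k + 1 => fun y => (k + 1) * greenOperator d (fun z => φ z * greenMoment d φ k z) y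

lemma greenMoment_succ (d : ℕ) (φ : Euc d → ℝ≥0∞) (k : ℕ) (y : Euc d) :
    greenMoment d φ (k + 1) y = (k + 1) * ∫⁻ τ in Set.Ioi (0 : ℝ),
      heatSemigroup d τ (fun z => φ z * greenMoment d φ k z) y :=
  rfl

lemma measurable_heatKernel (d : ℕ) :
    Measurable fun p : ℝ × Euc d => heatKernel d p.1 p.2 := by
  unfold heatKernel
  fun_prop

lemma heatKernel_pos {d : ℕ} {s : ℝ} (hs : 0 < s) (w : Euc d) : 0 < heatKernel d s w := by
  unfold heatKernel
  positivity

lemma heatKernel_le {d : ℕ} {s : ℝ} (hs : 0 < s) (w : Euc d) :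
    heatKernel d s w ≤ (2 * π * s) ^ (-(d : ℝ) / 2) := by
  unfold heatKernel
  refine mul_le_of_le_one_right (by positivity) ?_
  rw [Real.exp_le_one_iff, neg_div]
  exact neg_nonpos.2 (by positivity)

lemma continuous_heatKernel (d : ℕ) (s : ℝ) : Continuous (heatKernel d s) := by
  unfold heatKernel
  fun_prop

lemma lintegral_heatKernel {d : ℕ} {s : ℝ} (hs : 0 < s) (y : Euc d) :
    ∫⁻ z : Euc d, ENNReal.ofReal (heatKernel d s (z - y)) = 1 := by
  rw [lintegral_sub_right_eq_self (fun z : Euc d => ENNReal.ofReal (heatKernel d s z)) y]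
  have hb : 0 < 1 / (2 * s) := by positivity
  have hgauss := GaussianFourier.integral_rexp_neg_mul_sq_norm (V := Euc d) hb
  have hint : ∫ z : Euc d, heatKernel d s z = 1 := by
    have hc : (π / (1 / (2 * s))) = 2 * π * s := by field_simp
    have hfun : (fun z : Euc d => heatKernel d s z) = fun z =>
        (2 * π * s) ^ (-(d : ℝ) / 2) * Real.exp (-(1 / (2 * s)) * ‖z‖ ^ 2) := by
      ext z
      unfold heatKernel
      congr 2
      field_simp
    rw [hfun, integral_const_mul, hgauss, hc, finrank_euclideanSpace_fin,
      ← Real.rpow_add (by positivity), neg_div, neg_add_cancel, Real.rpow_zero]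
  rw [← ofReal_integral_eq_lintegral_ofReal _ (ae_of_all _ fun z => (heatKernel_pos hs z).le), hint,
    ENNReal.ofReal_one]
  exact Integrable.of_integral_ne_zero (by rw [hint]; exact one_ne_zero)

lemma measurable_heatSemigroup {d : ℕ} {φ : Euc d → ℝ≥0∞} (hφ : Measurable φ) :
    Measurable fun p : ℝ × Euc d => heatSemigroup d p.1 φ p.2 := by
  refine Measurable.lintegral_prod_right' (f := fun q : (ℝ × Euc d) × Euc d =>
    ENNReal.ofReal (heatKernel d q.1.1 (q.2 - q.1.2)) * φ q.2) ?_
  refine Measurable.mul (ENNReal.measurable_ofReal.comp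
    ((measurable_heatKernel d).comp (f := fun q : (ℝ × Euc d) × Euc d => (q.1.1, q.2 - q.1.2)) ?_))
    (hφ.comp measurable_snd)
  fun_prop

lemma measurable_heatSemigroup_comp {α : Type*} [MeasurableSpace α] {d : ℕ}
    {φ : Euc d → ℝ≥0∞} (hφ : Measurable φ) {τ : α → ℝ} {y : α → Euc d} (hτ : Measurable τ)
    (hy : Measurable y) : Measurable fun a => heatSemigroup d (τ a) φ (y a) :=
  Measurable.comp (g := fun p : ℝ × Euc d => heatSemigroup d p.1 φ p.2)
    (f := fun a => (τ a, y a)) (measurable_heatSemigroup hφ) (hτ.prodMk hy)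

lemma measurable_greenOperator {d : ℕ} {φ : Euc d → ℝ≥0∞} (hφ : Measurable φ) :
    Measurable (greenOperator d φ) := by
  have hm : Measurable fun q : Euc d × ℝ => heatSemigroup d q.2 φ q.1 :=
    measurable_heatSemigroup_comp hφ measurable_snd measurable_fst
  exact hm.lintegral_prod_right' (ν := volume.restrict (Set.Ioi (0 : ℝ)))

lemma measurable_greenMoment {d : ℕ} {φ : Euc d → ℝ≥0∞} (hφ : Measurable φ) (k : ℕ) :
    Measurable (greenMoment d φ k) := by
  induction k with
  | zero => exact measurable_const
  | succ k ih => exact (measurable_greenOperator (hφ.mul ih)).const_mul _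

lemma heatSemigroup_le_of_le {d : ℕ} {s : ℝ} (hs : 0 < s) {φ : Euc d → ℝ≥0∞} {C : ℝ≥0∞}
    (hC : ∀ z, φ z ≤ C) (y : Euc d) : heatSemigroup d s φ y ≤ C := by
  have hm : Measurable fun z : Euc d => ENNReal.ofReal (heatKernel d s (z - y)) :=
    ENNReal.measurable_ofReal.comp ((continuous_heatKernel d s).measurable.comp
      (measurable_id.sub_const y))
  calc heatSemigroup d s φ y ≤ ∫⁻ z, ENNReal.ofReal (heatKernel d s (z - y)) * C :=
        lintegral_mono fun z => by gcongr; exact hC z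
    _ = C := by rw [lintegral_mul_const _ hm, lintegral_heatKernel hs, one_mul]

lemma heatSemigroup_le_mul_lintegral {d : ℕ} {s : ℝ} (hs : 0 < s) {φ : Euc d → ℝ≥0∞}
    (hφ : Measurable φ) (y : Euc d) :
    heatSemigroup d s φ y ≤ ENNReal.ofReal ((2 * π * s) ^ (-(d : ℝ) / 2)) * ∫⁻ z, φ z := by
  rw [← lintegral_const_mul _ hφ]
  exact lintegral_mono fun z => by gcongr; exact heatKernel_le hs _

lemma continuous_heatSemigroup {d : ℕ} {s : ℝ} (hs : 0 < s) {φ : Euc d → ℝ≥0∞}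
    (hφ : Measurable φ) (hfin : ∀ z, φ z ≠ ∞) (hint : ∫⁻ z, φ z ≠ ∞) :
    Continuous (heatSemigroup d s φ) := by
  refine continuous_iff_continuousAt.2 fun y => ?_
  refine tendsto_lintegral_filter_of_dominated_convergence
    (fun z => ENNReal.ofReal ((2 * π * s) ^ (-(d : ℝ) / 2)) * φ z) ?_ ?_ ?_ ?_
  · refine Eventually.of_forall fun y => Measurable.mul ?_ hφ
    exact ENNReal.measurable_ofReal.comp ((continuous_heatKernel d s).measurable.comp
      (measurable_id.sub_const y))
  · refine Eventually.of_forall fun y => ae_of_all _ fun z => ?_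
    gcongr
    exact heatKernel_le hs _
  · rw [lintegral_const_mul _ hφ]
    exact ENNReal.mul_ne_top ENNReal.ofReal_ne_top hint
  · refine ae_of_all _ fun z => ENNReal.Tendsto.mul_const ?_ (Or.inr (hfin z))
    have hc : Continuous fun y : Euc d => ENNReal.ofReal (heatKernel d s (z - y)) :=
      ENNReal.continuous_ofReal.comp ((continuous_heatKernel d s).comp
        (continuous_const.sub continuous_id))
    exact hc.tendsto y

/-- In dimension at least three, the heat semigroup applied to a bounded integrable function is
dominated, uniformly in space, by an integrable function of time. -/
lemma exists_bound_heatSemigroup {d : ℕ} (hd : 3 ≤ d) {φ : Euc d → ℝ≥0∞} (hφ : Measurable φ)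
    {C : ℝ≥0∞} (hC : C ≠ ∞) (hφC : ∀ z, φ z ≤ C) (hint : ∫⁻ z, φ z ≠ ∞) :
    ∃ b : ℝ → ℝ≥0∞, ∫⁻ s in Set.Ioi (0 : ℝ), b s ≠ ∞ ∧
      ∀ s, 0 < s → ∀ y, heatSemigroup d s φ y ≤ b s := by
  set h : ℝ → ℝ≥0∞ := fun s => ENNReal.ofReal ((2 * π * s) ^ (-(d : ℝ) / 2)) * ∫⁻ z, φ z with hh
  refine ⟨fun s => min C (h s), ?_, fun s hs y =>
    le_min (heatSemigroup_le_of_le hs hφC y) (heatSemigroup_le_mul_lintegral hs hφ y)⟩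
  rw [← Set.Ioc_union_Ioi_eq_Ioi (zero_le_one' ℝ),
    lintegral_union measurableSet_Ioi (Set.Ioc_disjoint_Ioi le_rfl)]
  refine ENNReal.add_ne_top.2 ⟨?_, ?_⟩
  · refine ne_top_of_le_ne_top ?_ (lintegral_mono fun s => min_le_left C (h s))
    simpa using hC
  · refine ne_top_of_le_ne_top ?_ (lintegral_mono fun s => min_le_right C (h s))
    have hd' : -(d : ℝ) / 2 < -1 := by
      have : (3 : ℝ) ≤ d := by exact_mod_cast hd
      linarith
    have hi : IntegrableOn (fun s : ℝ => (2 * π * s) ^ (-(d : ℝ) / 2)) (Set.Ioi 1) := by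
      refine IntegrableOn.congr_fun ((integrableOn_Ioi_rpow_of_lt hd' one_pos).const_mul
        ((2 * π) ^ (-(d : ℝ) / 2))) (fun s hs => ?_) measurableSet_Ioi
      have hs' : (0 : ℝ) < s := lt_trans one_pos hs
      rw [Real.mul_rpow (by positivity) hs'.le]
    rw [hh, lintegral_mul_const _ (by fun_prop)]
    exact ENNReal.mul_ne_top hi.lintegral_lt_top.ne hint

lemma exists_bound_greenOperator {d : ℕ} (hd : 3 ≤ d) {φ : Euc d → ℝ≥0∞} (hφ : Measurable φ)
    {C : ℝ≥0∞} (hC : C ≠ ∞) (hφC : ∀ z, φ z ≤ C) (hint : ∫⁻ z, φ z ≠ ∞) :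
    ∃ K : ℝ≥0∞, K ≠ ∞ ∧ ∀ y, greenOperator d φ y ≤ K := by
  obtain ⟨b, hb, hle⟩ := exists_bound_heatSemigroup hd hφ hC hφC hint
  exact ⟨_, hb, fun y => setLIntegral_mono' measurableSet_Ioi fun s hs => hle s hs y⟩

lemma continuous_greenOperator {d : ℕ} (hd : 3 ≤ d) {φ : Euc d → ℝ≥0∞} (hφ : Measurable φ)
    {C : ℝ≥0∞} (hC : C ≠ ∞) (hφC : ∀ z, φ z ≤ C) (hint : ∫⁻ z, φ z ≠ ∞) :
    Continuous (greenOperator d φ) := by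
  obtain ⟨b, hb, hle⟩ := exists_bound_heatSemigroup hd hφ hC hφC hint
  refine continuous_iff_continuousAt.2 fun y =>
    tendsto_lintegral_filter_of_dominated_convergence b ?_ ?_ hb ?_
  · exact Eventually.of_forall fun y =>
      measurable_heatSemigroup_comp hφ measurable_id measurable_const
  · exact Eventually.of_forall fun y => ae_restrict_of_forall_mem measurableSet_Ioi
      fun s hs => hle s hs y
  · exact ae_restrict_of_forall_mem measurableSet_Ioi fun s hs =>
      (continuous_heatSemigroup hs hφ (fun z => ne_top_of_le_ne_top hC (hφC z)) hint).tendsto y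

lemma exists_bound_mul {d : ℕ} {φ ψ : Euc d → ℝ≥0∞} (hφ : Measurable φ)
    {C K : ℝ≥0∞} (hC : C ≠ ∞) (hφC : ∀ z, φ z ≤ C) (hint : ∫⁻ z, φ z ≠ ∞)
    (hK : K ≠ ∞) (hψK : ∀ z, ψ z ≤ K) :
    C * K ≠ ∞ ∧ (∀ z, φ z * ψ z ≤ C * K) ∧ ∫⁻ z, φ z * ψ z ≠ ∞ := by
  refine ⟨ENNReal.mul_ne_top hC hK, fun z => mul_le_mul' (hφC z) (hψK z), ?_⟩
  refine ne_top_of_le_ne_top (ENNReal.mul_ne_top hint hK) ?_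
  rw [← lintegral_mul_const _ hφ]
  exact lintegral_mono fun z => by gcongr; exact hψK z

lemma exists_bound_greenMoment {d : ℕ} (hd : 3 ≤ d) {φ : Euc d → ℝ≥0∞} (hφ : Measurable φ)
    {C : ℝ≥0∞} (hC : C ≠ ∞) (hφC : ∀ z, φ z ≤ C) (hint : ∫⁻ z, φ z ≠ ∞) (k : ℕ) :
    ∃ K : ℝ≥0∞, K ≠ ∞ ∧ ∀ y, greenMoment d φ k y ≤ K := by
  induction k with
  | zero => exact ⟨1, ENNReal.one_ne_top, fun y => le_rfl⟩
  | succ k ih =>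
    obtain ⟨K, hK, hle⟩ := ih
    obtain ⟨h1, h2, h3⟩ := exists_bound_mul hφ hC hφC hint hK hle
    obtain ⟨K', hK', hle'⟩ := exists_bound_greenOperator hd
      (hφ.mul (measurable_greenMoment hφ k)) h1 h2 h3
    exact ⟨(k + 1) * K', ENNReal.mul_ne_top (by finiteness) hK',
      fun y => mul_le_mul' le_rfl (hle' y)⟩

lemma continuous_greenMoment {d : ℕ} (hd : 3 ≤ d) {φ : Euc d → ℝ≥0∞} (hφ : Measurable φ)
    {C : ℝ≥0∞} (hC : C ≠ ∞) (hφC : ∀ z, φ z ≤ C) (hint : ∫⁻ z, φ z ≠ ∞) (k : ℕ) :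
    Continuous (greenMoment d φ k) := by
  cases k with
  | zero => exact continuous_const
  | succ k =>
    obtain ⟨K, hK, hle⟩ := exists_bound_greenMoment hd hφ hC hφC hint k
    obtain ⟨h1, h2, h3⟩ := exists_bound_mul hφ hC hφC hint hK hle
    exact (ENNReal.continuous_const_mul (by finiteness)).comp
      (continuous_greenOperator hd (hφ.mul (measurable_greenMoment hφ k)) h1 h2 h3)

lemma strictMono_snoc {n : ℕ} {s : Fin (n + 1) → ℝ} (hs : StrictMono s) {u : ℝ}
    (hu : s (Fin.last n) < u) : StrictMono (Fin.snoc s u : Fin (n + 2) → ℝ) := by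
  refine Fin.strictMono_iff_lt_succ.2 (Fin.lastCases ?_ fun i => ?_)
  · simpa using hu
  · rw [Fin.succ_castSucc, Fin.snoc_castSucc, Fin.snoc_castSucc]
    exact hs (Fin.castSucc_lt_succ)

/-- The finite-dimensional marginals of `X` at positive times are those of Brownian motion
started at `x`. -/
def HasBrownianMarginals {Ω : Type*} [MeasurableSpace Ω] {d : ℕ} (μ : Measure Ω) (x : Euc d)
    (X : ℝ → Ω → Euc d) : Prop :=
  ∀ (n : ℕ) (s : Fin (n + 1) → ℝ), StrictMono s → (∀ i, 0 < s i) →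
    Measure.map (fun ω (i : Fin (n + 1)) => X (s i) ω) μ =
      (volume : Measure (Fin (n + 1) → Euc d)).withDensity
        (fun z => ENNReal.ofReal (jointDensity d x s z))

lemma continuous_jointDensity {d n : ℕ} (x : Euc d) (s : Fin n → ℝ) :
    Continuous (jointDensity d x s) := by
  unfold jointDensity
  refine continuous_finsetProd _ fun j _ => (continuous_heatKernel d _).comp ?_
  split_ifs <;> fun_prop

lemma jointDensity_snoc {d n : ℕ} (x : Euc d) (s : Fin (n + 1) → ℝ) (u : ℝ)
    (z : Fin (n + 1) → Euc d) (w : Euc d) :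
    jointDensity d x (Fin.snoc s u : Fin (n + 2) → ℝ) (Fin.snoc z w : Fin (n + 2) → Euc d) =
      jointDensity d x s z * heatKernel d (u - s (Fin.last n)) (w - z (Fin.last n)) := by
  unfold jointDensity
  rw [Fin.prod_univ_castSucc]
  congr 1
  · refine Finset.prod_congr rfl fun j _ => ?_
    have hj : ∀ h, (⟨(j : ℕ) - 1, h⟩ : Fin (n + 2)) =
        Fin.castSucc ⟨(j : ℕ) - 1, lt_of_le_of_lt (Nat.sub_le _ _) j.isLt⟩ := fun _ => rfl
    simp only [Fin.val_castSucc, hj, Fin.snoc_castSucc]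
  · have hl : ∀ h, (⟨n + 1 - 1, h⟩ : Fin (n + 2)) = Fin.castSucc (Fin.last n) := fun _ => rfl
    simp only [Fin.val_last, hl, Fin.snoc_castSucc, Fin.snoc_last, Nat.succ_ne_zero, if_false]

lemma jointDensity_pos {d n : ℕ} (x : Euc d) {s : Fin (n + 1) → ℝ} (hs : StrictMono s)
    (hs0 : ∀ i, 0 < s i) (z : Fin (n + 1) → Euc d) : 0 < jointDensity d x s z := by
  refine Finset.prod_pos fun j _ => heatKernel_pos ?_ _
  split_ifs with h
  · simpa using hs0 j
  · exact sub_pos.2 (hs (Fin.lt_def.2 (Nat.sub_lt (Nat.pos_of_ne_zero h) one_pos)))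

section Markov

variable {Ω : Type*} [MeasurableSpace Ω] {d : ℕ} {μ : Measure Ω} {x : Euc d} {X : ℝ → Ω → Euc d}

lemma HasBrownianMarginals.lintegral_comp (hX : HasBrownianMarginals μ x X)
    (hm : Measurable (Function.uncurry X)) {n : ℕ} {s : Fin (n + 1) → ℝ} (hs : StrictMono s)
    (hs0 : ∀ i, 0 < s i) {f : (Fin (n + 1) → Euc d) → ℝ≥0∞} (hf : Measurable f) :
    ∫⁻ ω, f (fun i => X (s i) ω) ∂μ = ∫⁻ z, ENNReal.ofReal (jointDensity d x s z) * f z := by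
  have hXm : Measurable fun ω (i : Fin (n + 1)) => X (s i) ω :=
    measurable_pi_lambda _ fun i => hm.comp (measurable_const.prodMk measurable_id)
  rw [← lintegral_map hf hXm, hX n s hs hs0, lintegral_withDensity_eq_lintegral_mul _ _ hf]
  · rfl
  · exact ENNReal.measurable_ofReal.comp (continuous_jointDensity x s).measurable

/-- The law at a single time is given by the heat semigroup. -/
lemma HasBrownianMarginals.lintegral_comp_single (hX : HasBrownianMarginals μ x X)
    (hm : Measurable (Function.uncurry X)) {u : ℝ} (hu : 0 < u) {φ : Euc d → ℝ≥0∞}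
    (hφ : Measurable φ) : ∫⁻ ω, φ (X u ω) ∂μ = heatSemigroup d u φ x := by
  rw [hX.lintegral_comp hm (n := 0) (s := fun _ => u) (Subsingleton.strictMono (α := Fin 1) _) (fun _ => hu)
    (f := fun z => φ (z 0)) (hφ.comp (measurable_pi_apply 0))]
  have hmp := (volume_preserving_funUnique (Fin 1) (Euc d)).symm
  refine (hmp.lintegral_comp_emb (MeasurableEquiv.measurableEmbedding _) _).symm.trans ?_
  refine lintegral_congr fun z => ?_
  simp [jointDensity, MeasurableEquiv.funUnique]

/-- The Markov property of Brownian motion. -/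
lemma HasBrownianMarginals.lintegral_comp_mul (hX : HasBrownianMarginals μ x X)
    (hm : Measurable (Function.uncurry X)) {n : ℕ} {s : Fin (n + 1) → ℝ} (hs : StrictMono s)
    (hs0 : ∀ i, 0 < s i) {u : ℝ} (hu : s (Fin.last n) < u)
    {f : (Fin (n + 1) → Euc d) → ℝ≥0∞} (hf : Measurable f) {φ : Euc d → ℝ≥0∞}
    (hφ : Measurable φ) :
    ∫⁻ ω, f (fun i => X (s i) ω) * φ (X u ω) ∂μ =
      ∫⁻ ω, f (fun i => X (s i) ω) *
        heatSemigroup d (u - s (Fin.last n)) φ (X (s (Fin.last n)) ω) ∂μ := by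
  have hsu : StrictMono (Fin.snoc s u : Fin (n + 2) → ℝ) := strictMono_snoc hs hu
  have hsu0 : ∀ i, 0 < (Fin.snoc s u : Fin (n + 2) → ℝ) i := by
    refine Fin.lastCases ?_ fun i => ?_
    · simpa using (hs0 _).trans hu
    · simpa using hs0 i
  have hPm : Measurable (heatSemigroup d (u - s (Fin.last n)) φ) :=
    measurable_heatSemigroup_comp hφ measurable_const measurable_id
  have hF : Measurable fun z : Fin (n + 2) → Euc d => f (fun i => z i.castSucc) * φ (z (Fin.last (n + 1))) :=
    (hf.comp (measurable_pi_lambda _ fun i => measurable_pi_apply i.castSucc)).mul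
      (hφ.comp (measurable_pi_apply _))
  have hl := hX.lintegral_comp hm hsu hsu0 hF
  have hr := hX.lintegral_comp hm hs hs0 (f := fun z =>
    f z * heatSemigroup d (u - s (Fin.last n)) φ (z (Fin.last n)))
    (hf.mul (hPm.comp (measurable_pi_apply _)))
  simp only [Fin.snoc_castSucc, Fin.snoc_last] at hl
  rw [hl, hr, ← (volume_preserving_piFinSuccAbove (fun _ : Fin (n + 2) => Euc d)
    (Fin.last (n + 1))).symm.lintegral_comp_emb (MeasurableEquiv.measurableEmbedding _)]
  have hsnoc : ∀ p : Euc d × (Fin (n + 1) → Euc d),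
      (MeasurableEquiv.piFinSuccAbove (fun _ : Fin (n + 2) => Euc d) (Fin.last (n + 1))).symm p =
        (Fin.snoc p.2 p.1 : Fin (n + 2) → Euc d) := fun p => by
    rw [MeasurableEquiv.piFinSuccAbove_symm_apply]
    exact Fin.insertNth_last' p.1 p.2
  simp only [hsnoc, jointDensity_snoc, Fin.snoc_castSucc, Fin.snoc_last]
  have hJm := ENNReal.measurable_ofReal.comp (continuous_jointDensity x s).measurable
  have hqm : Measurable fun p : Euc d × (Fin (n + 1) → Euc d) => ENNReal.ofReal
      (heatKernel d (u - s (Fin.last n)) (p.1 - p.2 (Fin.last n))) :=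
    ENNReal.measurable_ofReal.comp ((continuous_heatKernel d _).measurable.comp (by fun_prop))
  simp only [ENNReal.ofReal_mul (jointDensity_pos x hs hs0 _).le]
  rw [Measure.volume_eq_prod, lintegral_prod_symm']
  · refine lintegral_congr fun z => ?_
    rw [heatSemigroup, ← mul_assoc, ← lintegral_const_mul]
    · refine lintegral_congr fun w => ?_
      simp only
      ring
    · exact (hqm.comp (measurable_id.prodMk measurable_const)).mul hφ
  · exact ((hJm.comp measurable_snd).mul hqm).mul
      ((hf.comp measurable_snd).mul (hφ.comp measurable_fst))

lemma measurable_lintegral_Ioi_comp (hm : Measurable (Function.uncurry X)) {φ : Euc d → ℝ≥0∞}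
    (hφ : Measurable φ) :
    Measurable fun p : ℝ × Ω => ∫⁻ u in Set.Ioi p.1, φ (X u p.2) := by
  have hset : MeasurableSet {q : (ℝ × Ω) × ℝ | q.1.1 < q.2} :=
    measurableSet_lt (by fun_prop) (by fun_prop)
  have hmeas : Measurable fun q : (ℝ × Ω) × ℝ => φ (X q.2 q.1.2) :=
    hφ.comp (hm.comp (f := fun q : (ℝ × Ω) × ℝ => (q.2, q.1.2)) (by fun_prop))
  have h := (hmeas.indicator hset).lintegral_prod_right' (ν := volume)
  convert h using 2 with p
  rw [← lintegral_indicator measurableSet_Ioi]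
  rfl

lemma lintegral_mul_pow_succ [SFinite μ] (hm : Measurable (Function.uncurry X))
    {φ : Euc d → ℝ≥0∞} (hφ : Measurable φ) {F : Ω → ℝ≥0∞} (hF : Measurable F) (k : ℕ) (t : ℝ) :
    ∫⁻ ω, F ω * (∫⁻ u in Set.Ioi t, φ (X u ω)) ^ (k + 1) ∂μ =
      (k + 1) * ∫⁻ s in Set.Ioi t,
        ∫⁻ ω, F ω * φ (X s ω) * (∫⁻ u in Set.Ioi s, φ (X u ω)) ^ k ∂μ := by
  have hφX : Measurable fun p : ℝ × Ω => φ (X p.1 p.2) := hφ.comp hm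
  have hR := measurable_lintegral_Ioi_comp hm hφ
  have hmeas : Measurable fun p : ℝ × Ω =>
      F p.2 * φ (X p.1 p.2) * (∫⁻ u in Set.Ioi p.1, φ (X u p.2)) ^ k :=
    ((hF.comp measurable_snd).mul hφX).mul (hR.pow_const k)
  have hmeas' : Measurable fun p : Ω × ℝ =>
      F p.1 * φ (X p.2 p.1) * (∫⁻ u in Set.Ioi p.2, φ (X u p.1)) ^ k := hmeas.comp measurable_swap
  rw [lintegral_lintegral_swap hmeas.aemeasurable, ← lintegral_const_mul _
    hmeas'.lintegral_prod_right']
  refine lintegral_congr fun ω => ?_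
  have hg : Measurable fun s => φ (X s ω) := hφX.comp (measurable_id.prodMk measurable_const)
  rw [lintegral_Ioi_pow_succ hg, mul_left_comm, ← lintegral_const_mul]
  · simp only [mul_assoc]
  · exact hg.mul ((measurable_lintegral_Ioi _).pow_const k)

lemma HasBrownianMarginals.lintegral_comp_mul_pow [SFinite μ] (hX : HasBrownianMarginals μ x X)
    (hm : Measurable (Function.uncurry X)) {φ : Euc d → ℝ≥0∞} (hφ : Measurable φ) (k : ℕ) :
    ∀ {n : ℕ} {s : Fin (n + 1) → ℝ}, StrictMono s → (∀ i, 0 < s i) →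
    ∀ {f : (Fin (n + 1) → Euc d) → ℝ≥0∞}, Measurable f →
    ∫⁻ ω, f (fun i => X (s i) ω) * (∫⁻ u in Set.Ioi (s (Fin.last n)), φ (X u ω)) ^ k ∂μ =
      ∫⁻ ω, f (fun i => X (s i) ω) * greenMoment d φ k (X (s (Fin.last n)) ω) ∂μ := by
  induction k with
  | zero => intros; simp [greenMoment]
  | succ k ih =>
    intro n s hs hs0 f hf
    set t := s (Fin.last n) with ht
    have hXm : ∀ r, Measurable (X r) := fun r => hm.comp (measurable_const.prodMk measurable_id)
    have hF : Measurable fun ω => f (fun i => X (s i) ω) :=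
      hf.comp (measurable_pi_lambda _ fun i => hXm _)
    have hψ : Measurable fun z => φ z * greenMoment d φ k z :=
      hφ.mul (measurable_greenMoment hφ k)
    have hstep : ∀ u ∈ Set.Ioi t,
        ∫⁻ ω, f (fun i => X (s i) ω) * φ (X u ω) * (∫⁻ r in Set.Ioi u, φ (X r ω)) ^ k ∂μ =
          ∫⁻ ω, f (fun i => X (s i) ω) *
            heatSemigroup d (u - t) (fun z => φ z * greenMoment d φ k z) (X t ω) ∂μ := by
      intro u hu
      have hsu0 : ∀ i, 0 < (Fin.snoc s u : Fin (n + 2) → ℝ) i := by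
        refine Fin.lastCases ?_ fun i => ?_
        · simpa using (hs0 _).trans hu
        · simpa using hs0 i
      have h := ih (strictMono_snoc hs hu) hsu0
        (f := fun z : Fin (n + 2) → Euc d => f (fun i => z i.castSucc) * φ (z (Fin.last (n + 1))))
        ((hf.comp (measurable_pi_lambda _ fun i => measurable_pi_apply i.castSucc)).mul
          (hφ.comp (measurable_pi_apply _)))
      simp only [Fin.snoc_castSucc, Fin.snoc_last] at h
      rw [h, ← hX.lintegral_comp_mul hm hs hs0 hu hf hψ]
      simp only [mul_assoc]
    have hP : Measurable fun p : ℝ × Ω => f (fun i => X (s i) p.2) *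
        heatSemigroup d (p.1 - t) (fun z => φ z * greenMoment d φ k z) (X t p.2) :=
      (hF.comp measurable_snd).mul (measurable_heatSemigroup_comp hψ
        (measurable_fst.sub_const t) ((hXm t).comp measurable_snd))
    have hP' : Measurable fun p : Ω × ℝ => f (fun i => X (s i) p.1) *
        heatSemigroup d (p.2 - t) (fun z => φ z * greenMoment d φ k z) (X t p.1) :=
      hP.comp measurable_swap
    rw [lintegral_mul_pow_succ hm hφ hF, setLIntegral_congr_fun measurableSet_Ioi hstep,
      lintegral_lintegral_swap hP.aemeasurable, ← lintegral_const_mul _ hP'.lintegral_prod_right']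
    refine lintegral_congr fun ω => ?_
    have hQ : Measurable fun u : ℝ =>
        heatSemigroup d u (fun z => φ z * greenMoment d φ k z) (X t ω) :=
      measurable_heatSemigroup_comp hψ measurable_id measurable_const
    have hshift := lintegral_sub_right_eq_self (μ := volume) (fun u : ℝ =>
      (Set.Ioi (0 : ℝ)).indicator (fun u =>
        heatSemigroup d u (fun z => φ z * greenMoment d φ k z) (X t ω)) u) t
    rw [lintegral_indicator measurableSet_Ioi] at hshift
    have hQ' : Measurable fun u : ℝ =>
        heatSemigroup d (u - t) (fun z => φ z * greenMoment d φ k z) (X t ω) :=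
      hQ.comp (measurable_id.sub_const t)
    simp only
    rw [greenMoment_succ, ← hshift, lintegral_const_mul _ hQ', ← lintegral_indicator measurableSet_Ioi, mul_left_comm]
    congr 3
    ext u
    simp [Set.indicator_apply]

/-- The moments of the total path integral of a nonnegative function along Brownian motion. -/
lemma HasBrownianMarginals.lintegral_pow [IsProbabilityMeasure μ] (hX : HasBrownianMarginals μ x X)
    (hm : Measurable (Function.uncurry X)) {φ : Euc d → ℝ≥0∞} (hφ : Measurable φ) (k : ℕ) :
    ∫⁻ ω, (∫⁻ u in Set.Ioi (0 : ℝ), φ (X u ω)) ^ k ∂μ = greenMoment d φ k x := by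
  cases k with
  | zero => simp [greenMoment]
  | succ k =>
    have h := lintegral_mul_pow_succ (μ := μ) hm hφ (F := fun _ => 1) measurable_const k 0
    simp only [one_mul] at h
    rw [h, greenMoment_succ]
    congr 1
    refine setLIntegral_congr_fun measurableSet_Ioi fun u hu => ?_
    have hu' : (0 : ℝ) < u := hu
    have h1 := hX.lintegral_comp_mul_pow hm hφ k (n := 0) (s := fun _ => u)
      (Subsingleton.strictMono (α := Fin 1) _) (fun _ => hu') (f := fun z => φ (z 0))
      (hφ.comp (measurable_pi_apply 0))
    simp only at h1 ⊢
    rw [h1]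
    exact hX.lintegral_comp_single hm hu' (hφ.mul (measurable_greenMoment hφ k))

end Markov

lemma IsBrownianMotion.aemeasurable {Ω : Type*} [MeasureSpace Ω] {d : ℕ} {x : Euc d}
    {W : ℝ → Ω → Euc d} (hW : IsBrownianMotion x W) {s : ℝ} (hs : 0 ≤ s) :
    AEMeasurable (W s) (ℙ : Measure Ω) := by
  rcases hs.eq_or_lt with rfl | hs
  · exact (measurable_const (a := x)).aemeasurable.congr (ae_of_all _ fun ω => (hW.1 ω).symm)
  · have h := hW.2.2 0 (fun _ => s) (Subsingleton.strictMono (α := Fin 1) _) (fun _ => hs)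
    have hne : Measure.map (fun ω (_ : Fin (0 + 1)) => W s ω) (ℙ : Measure Ω) ≠ 0 := by
      intro h0
      rw [h] at h0
      have hm : Measurable fun z : Fin (0 + 1) → Euc d =>
          ENNReal.ofReal (jointDensity d x (fun _ => s) z) :=
        ENNReal.measurable_ofReal.comp (continuous_jointDensity x _).measurable
      rw [withDensity_eq_zero_iff hm.aemeasurable] at h0
      have hF : ∀ᵐ _ : Fin (0 + 1) → Euc d, False := by
        filter_upwards [h0] with z hz
        have hpos := jointDensity_pos x (Subsingleton.strictMono (α := Fin 1) fun _ => s)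
          (fun _ => hs) z
        simp only [Pi.zero_apply, ENNReal.ofReal_eq_zero] at hz
        exact absurd hz (not_le.2 hpos)
      rw [eventually_false_iff_eq_bot, ae_eq_bot] at hF
      exact NeZero.ne _ hF
    exact (measurable_pi_apply (0 : Fin (0 + 1))).comp_aemeasurable
      (AEMeasurable.of_map_ne_zero hne)

/-- A Brownian motion has a jointly measurable modification, indistinguishable from it at positive
times. -/
lemma IsBrownianMotion.exists_measurable_modification {Ω : Type*} [MeasureSpace Ω] {d : ℕ}
    {x : Euc d} {W : ℝ → Ω → Euc d} (hW : IsBrownianMotion x W) :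
    ∃ X : ℝ → Ω → Euc d, Measurable (Function.uncurry X) ∧
      (∀ᵐ ω ∂(ℙ : Measure Ω), ∀ s, 0 < s → X s ω = W s ω) ∧
      HasBrownianMarginals (ℙ : Measure Ω) x X := by
  have hV : ∀ s : ℝ, AEMeasurable (W |s|) (ℙ : Measure Ω) := fun s => hW.aemeasurable (abs_nonneg s)
  have hae : ∀ᵐ ω ∂(ℙ : Measure Ω), ∀ q : ℚ, W |(q : ℝ)| ω = (hV q).mk _ ω :=
    ae_all_iff.2 fun q => (hV q).ae_eq_mk
  obtain ⟨N, hsub, hN, hN0⟩ := exists_measurable_superset_of_null (ae_iff.1 hae)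
  have hout : ∀ ω, ω ∉ N → ∀ q : ℚ, W |(q : ℝ)| ω = (hV q).mk _ ω := fun ω hω => by
    by_contra h
    exact hω (hsub h)
  classical
  let X : ℝ → Ω → Euc d := fun s ω => if ω ∈ N then x else W |s| ω
  have hcont : ∀ ω, Continuous fun s => X s ω := fun ω => by
    by_cases h : ω ∈ N
    · simpa only [X, h, if_true] using continuous_const
    · simpa only [X, h, if_false, Function.comp_def] using (hW.2.1 ω).comp continuous_abs
  have hrat : ∀ q : ℚ, Measurable (X q) := fun q => by
    have hX : X q = fun ω => if ω ∈ N then x else (hV q).mk _ ω := by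
      ext1 ω
      by_cases h : ω ∈ N
      · simp only [X, h, if_true]
      · simp only [X, h, if_false, hout ω h q]
    rw [hX]
    exact Measurable.ite hN measurable_const (hV q).measurable_mk
  have hmeas : ∀ s, Measurable (X s) := fun s => by
    obtain ⟨u, hu, hlim⟩ := mem_closure_iff_seq_limit.1 (Rat.denseRange_cast (𝕜 := ℝ) s)
    choose q hq using hu
    refine measurable_of_tendsto_metrizable (f := fun n => X (q n)) (fun n => hrat (q n)) ?_
    refine tendsto_pi_nhds.2 fun ω => ?_
    simp only [hq]
    exact ((hcont ω).tendsto s).comp hlim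
  have hXW : ∀ᵐ ω ∂(ℙ : Measure Ω), ∀ s, 0 < s → X s ω = W s ω := by
    filter_upwards [compl_mem_ae_iff.2 hN0] with ω hω s hs
    simp only [X, if_neg hω, abs_of_pos hs]
  refine ⟨X, measurable_uncurry_of_continuous_of_measurable hcont hmeas, hXW, ?_⟩
  intro n s hs hs0
  rw [← hW.2.2 n s hs hs0]
  refine Measure.map_congr ?_
  filter_upwards [hXW] with ω hω
  ext1 i
  exact hω (s i) (hs0 i)

lemma HasBrownianMarginals.integral_toReal_pow {Ω : Type*} [MeasurableSpace Ω] {d : ℕ}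
    {μ : Measure Ω} [IsProbabilityMeasure μ] {x : Euc d} {X : ℝ → Ω → Euc d}
    (hX : HasBrownianMarginals μ x X) (hm : Measurable (Function.uncurry X)) {φ : Euc d → ℝ≥0∞}
    (hφ : Measurable φ) (hfin : ∀ k, greenMoment d φ k x ≠ ∞) :
    (∀ᵐ ω ∂μ, ∫⁻ u in Set.Ioi (0 : ℝ), φ (X u ω) < ∞) ∧
    ∀ k, Integrable (fun ω => (∫⁻ u in Set.Ioi (0 : ℝ), φ (X u ω)).toReal ^ k) μ ∧
      ∫ ω, (∫⁻ u in Set.Ioi (0 : ℝ), φ (X u ω)).toReal ^ k ∂μ = (greenMoment d φ k x).toReal := by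
  have hmom := hX.lintegral_pow hm hφ
  have hR : Measurable fun ω => ∫⁻ u in Set.Ioi (0 : ℝ), φ (X u ω) :=
    (measurable_lintegral_Ioi_comp hm hφ).comp (measurable_const.prodMk measurable_id)
  have hlt : ∀ᵐ ω ∂μ, ∫⁻ u in Set.Ioi (0 : ℝ), φ (X u ω) < ∞ := by
    refine ae_lt_top hR ?_
    have h1 := hmom 1
    simp only [pow_one] at h1
    rw [h1]
    exact hfin 1
  refine ⟨hlt, fun k => ⟨?_, ?_⟩⟩
  · simp only [← ENNReal.toReal_pow]
    refine integrable_toReal_of_lintegral_ne_top (hR.pow_const k).aemeasurable ?_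
    rw [hmom k]
    exact hfin k
  · simp only [← ENNReal.toReal_pow]
    rw [integral_toReal (hR.pow_const k).aemeasurable, hmom k]
    filter_upwards [hlt] with ω hω
    exact ENNReal.pow_lt_top hω

lemma exists_sub_pow_eq_sum (k : ℕ) :
    ∃ c : ℕ → ℝ, ∀ a b : ℝ,
      (a - b) ^ k = ∑ i ∈ Finset.range (k + 1), c i * (a + i * b) ^ k := by
  refine ⟨fun i => -((-1) ^ (k + 1) * ((-1) ^ (k + 1 - (i + 1)) * (k + 1).choose (i + 1))),
    fun a b => ?_⟩
  set p : Polynomial ℝ := (Polynomial.C a + Polynomial.X * Polynomial.C b) ^ k with hp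
  have hdeg : p.natDegree < k + 1 := by
    refine Nat.lt_succ_of_le ?_
    rw [hp]
    compute_degree
  have h := congrFun (Polynomial.fwdDiff_iter_eq_zero_of_degree_lt hdeg) (-1)
  rw [fwdDiff_iter_eq_sum_shift, Finset.sum_range_succ'] at h
  have heval : ∀ r, Polynomial.eval r p = (a + r * b) ^ k := fun r => by
    simp only [hp, Polynomial.eval_pow, Polynomial.eval_add, Polynomial.eval_mul,
      Polynomial.eval_C, Polynomial.eval_X]
  have hsign : ((-1 : ℝ) ^ (k + 1)) * (-1) ^ (k + 1) = 1 := by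
    rw [← mul_pow]; simp
  have h' : ∑ i ∈ Finset.range (k + 1),
      (-1) ^ (k + 1 - (i + 1)) * ((k + 1).choose (i + 1) : ℝ) * (a + i * b) ^ k +
        (-1) ^ (k + 1) * (a - b) ^ k = 0 := by
    rw [Pi.zero_apply] at h
    rw [← h]
    congr 1
    · refine Finset.sum_congr rfl fun i _ => ?_
      simp [heval]
    · simp [heval, ← sub_eq_add_neg]
  have hsum : ∑ i ∈ Finset.range (k + 1),
      -((-1) ^ (k + 1) * ((-1) ^ (k + 1 - (i + 1)) * ((k + 1).choose (i + 1) : ℝ))) *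
        (a + i * b) ^ k =
      -(-1) ^ (k + 1) * ∑ i ∈ Finset.range (k + 1),
        (-1) ^ (k + 1 - (i + 1)) * ((k + 1).choose (i + 1) : ℝ) * (a + i * b) ^ k := by
    rw [Finset.mul_sum]
    exact Finset.sum_congr rfl fun i _ => by ring
  rw [hsum, eq_neg_of_add_eq_zero_left h']
  linear_combination (-(a - b) ^ k) * hsign

/-- The combination `v⁺ + i v⁻` of the positive and negative parts of `v`. -/
def partComb {d : ℕ} (v : Euc d → ℝ) (i : ℕ) (z : Euc d) : ℝ≥0∞ :=
  ENNReal.ofReal (v z) + i * ENNReal.ofReal (-v z)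

lemma measurable_partComb {d : ℕ} {v : Euc d → ℝ} (hv : Measurable v) (i : ℕ) :
    Measurable (partComb v i) :=
  hv.ennreal_ofReal.add (hv.neg.ennreal_ofReal.const_mul _)

lemma partComb_le {d : ℕ} {v : Euc d → ℝ} {C : ℝ} (hC : ∀ z, |v z| ≤ C) (i : ℕ) (z : Euc d) :
    partComb v i z ≤ ENNReal.ofReal C + i * ENNReal.ofReal C := by
  unfold partComb
  gcongr
  · exact (le_abs_self _).trans (hC z)
  · exact (neg_le_abs _).trans (hC z)

lemma lintegral_partComb_ne_top {d : ℕ} {v : Euc d → ℝ} {C : ℝ} (hC : ∀ z, |v z| ≤ C) {R : ℝ}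
    (hR : ∀ z, v z ≠ 0 → ‖z‖ ≤ R) (i : ℕ) : ∫⁻ z, partComb v i z ≠ ∞ := by
  have hle : ∀ z, partComb v i z ≤ (Metric.closedBall (0 : Euc d) R).indicator
      (fun _ => ENNReal.ofReal C + i * ENNReal.ofReal C) z := fun z => by
    by_cases hz : z ∈ Metric.closedBall (0 : Euc d) R
    · rw [Set.indicator_of_mem hz]
      exact partComb_le hC i z
    · have hv : v z = 0 := by
        by_contra h
        exact hz (by simpa using hR z h)
      simp [partComb, hv]
  refine ne_top_of_le_ne_top ?_ (lintegral_mono hle)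
  rw [lintegral_indicator_const Metric.isClosed_closedBall.measurableSet]
  exact ENNReal.mul_ne_top (by finiteness) measure_closedBall_lt_top.ne

lemma enorm_le_partComb_one {d : ℕ} (v : Euc d → ℝ) (z : Euc d) : ‖v z‖ₑ ≤ partComb v 1 z := by
  rw [partComb, Nat.cast_one, one_mul, Real.enorm_eq_ofReal_abs]
  rcases abs_cases (v z) with ⟨h, _⟩ | ⟨h, _⟩ <;> rw [h]
  · exact le_self_add
  · exact le_add_self

/-- A power of the path integral of a signed function as a combination of powers of path integrals
of nonnegative functions. -/
lemma integral_Ioi_pow_eq_sum {d : ℕ} {v : Euc d → ℝ} (hv : Measurable v) {w : ℝ → Euc d}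
    (hw : Measurable w) (hfin : ∫⁻ s in Set.Ioi (0 : ℝ), partComb v 1 (w s) < ∞)
    {k : ℕ} {c : ℕ → ℝ}
    (hc : ∀ a b : ℝ, (a - b) ^ k = ∑ i ∈ Finset.range (k + 1), c i * (a + i * b) ^ k) :
    (∫ s in Set.Ioi (0 : ℝ), v (w s)) ^ k = ∑ i ∈ Finset.range (k + 1),
      c i * (∫⁻ s in Set.Ioi (0 : ℝ), partComb v i (w s)).toReal ^ k := by
  have hvw : Measurable fun s => v (w s) := hv.comp hw
  have hsplit : ∀ i : ℕ, ∫⁻ s in Set.Ioi (0 : ℝ), partComb v i (w s) =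
      (∫⁻ s in Set.Ioi (0 : ℝ), ENNReal.ofReal (v (w s))) +
        i * ∫⁻ s in Set.Ioi (0 : ℝ), ENNReal.ofReal (-v (w s)) := fun i => by
    unfold partComb
    have hneg : Measurable fun s => ENNReal.ofReal (-v (w s)) := hvw.neg.ennreal_ofReal
    rw [lintegral_add_left hvw.ennreal_ofReal, lintegral_const_mul _ hneg]
  have hint : IntegrableOn (fun s => v (w s)) (Set.Ioi (0 : ℝ)) :=
    ⟨hvw.aestronglyMeasurable,
      (lintegral_mono fun s => enorm_le_partComb_one v (w s)).trans_lt hfin⟩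
  have hne := hfin.ne
  rw [hsplit, Nat.cast_one, one_mul, ENNReal.add_ne_top] at hne
  rw [integral_eq_lintegral_pos_part_sub_lintegral_neg_part hint, hc]
  refine Finset.sum_congr rfl fun i _ => ?_
  rw [hsplit, ENNReal.toReal_add hne.1 (ENNReal.mul_ne_top (by finiteness) hne.2),
    ENNReal.toReal_mul, ENNReal.toReal_natCast]

/-- Lemma 2 (moments): each moment `E[(Y_x)^k]` is continuous in the starting point `x`. -/
theorem stmt5 (d : ℕ) (hd : 3 ≤ d) (v : Euc d → ℝ)
    (hvm : Measurable v) (hvb : ∃ C : ℝ, ∀ z, |v z| ≤ C)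
    (hvs : ∃ R : ℝ, ∀ z, v z ≠ 0 → ‖z‖ ≤ R)
    {Ω : Type*} [MeasureSpace Ω] [IsProbabilityMeasure (ℙ : Measure Ω)]
    (W : Euc d → ℝ → Ω → Euc d) (hW : ∀ x, IsBrownianMotion x (W x)) :
    ∀ k : ℕ, Continuous fun x : Euc d => ∫ ω, (pathIntInf v (W x) ω) ^ k := by
  intro k
  obtain ⟨C, hC⟩ := hvb
  obtain ⟨R, hR⟩ := hvs
  obtain ⟨c, hc⟩ := exists_sub_pow_eq_sum k
  have hCtop : ∀ i : ℕ, ENNReal.ofReal C + i * ENNReal.ofReal C ≠ ∞ := fun i => by finiteness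
  have hfin : ∀ i j x, greenMoment d (partComb v i) j x ≠ ∞ := fun i j x => by
    obtain ⟨K, hK, hle⟩ := exists_bound_greenMoment hd (measurable_partComb hvm i) (hCtop i)
      (partComb_le hC i) (lintegral_partComb_ne_top hC hR i) j
    exact ne_top_of_le_ne_top hK (hle x)
  have hcont : ∀ i, Continuous (greenMoment d (partComb v i) k) := fun i =>
    continuous_greenMoment hd (measurable_partComb hvm i) (hCtop i) (partComb_le hC i)
      (lintegral_partComb_ne_top hC hR i) k
  have hmoment : ∀ x, ∫ ω, (pathIntInf v (W x) ω) ^ k =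
      ∑ i ∈ Finset.range (k + 1), c i * (greenMoment d (partComb v i) k x).toReal := fun x => by
    obtain ⟨X, hXm, hXW, hX⟩ := (hW x).exists_measurable_modification
    have hpow := fun i => hX.integral_toReal_pow hXm (measurable_partComb hvm i)
      fun j => hfin i j x
    have hae : ∀ᵐ ω ∂(ℙ : Measure Ω), (pathIntInf v (W x) ω) ^ k =
        ∑ i ∈ Finset.range (k + 1),
          c i * (∫⁻ s in Set.Ioi (0 : ℝ), partComb v i (X s ω)).toReal ^ k := by
      filter_upwards [hXW, (hpow 1).1] with ω hω hlt
      have hw : Measurable fun s => X s ω := hXm.comp (measurable_id.prodMk measurable_const)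
      rw [← integral_Ioi_pow_eq_sum hvm hw hlt hc, pathIntInf]
      congr 1
      refine setIntegral_congr_fun measurableSet_Ioi fun s hs => ?_
      exact congrArg v (hω s hs).symm
    rw [integral_congr_ae hae, integral_finsetSum _ fun i _ => ((hpow i).2 k).1.const_mul (c i)]
    refine Finset.sum_congr rfl fun i _ => ?_
    rw [integral_const_mul, ((hpow i).2 k).2]
  simp only [hmoment]
  refine continuous_finsetSum _ fun i _ => continuous_const.mul ?_
  exact ENNReal.continuousOn_toReal.comp_continuous (hcont i) fun x => hfin i k x

end
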